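/- arXiv:1904.06053 — 2 statements merged into one kernel-verified Lean document; each statement's English description precedes it below -/
import Mathlib

section
/- If $g:\mathbb{R}^d \to [0,+\infty)$ is log-concave and integrable, then for any $\varepsilon > 0$ the function $P^\varepsilon g$ is log-concave, where $P^\varepsilon$ is the Ornstein–Uhlenbeck semigroup. -/
open MeasureTheory Real

/-- The Ornstein–Uhlenbeck semigroup at time `ε`. -/
noncomputable def OU (d : ℕ) (ε : ℝ) (f : EuclideanSpace ℝ (Fin d) → ℝ)
    (x : EuclideanSpace ℝ (Fin d)) : ℝ :=
  (2 * π * (1 - Real.exp (-ε))) ^ (-(d : ℝ) / 2) *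
    ∫ y, f (y + Real.exp (-ε / 2) • x) * Real.exp (-‖y‖ ^ 2 / (2 * (1 - Real.exp (-ε))))

/-- A nonnegative function is log-concave. -/
def LogConcaveFn {d : ℕ} (ρ : EuclideanSpace ℝ (Fin d) → ℝ) : Prop :=
  (∀ x, 0 ≤ ρ x) ∧ ∀ x y : EuclideanSpace ℝ (Fin d), ∀ a b : ℝ,
    0 ≤ a → 0 ≤ b → a + b = 1 → ρ x ^ a * ρ y ^ b ≤ ρ (a • x + b • y)

open scoped ENNReal Pointwise

namespace PLaux

/-- One-dimensional Brunn–Minkowski for nonempty compact sets. -/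
lemma bm_compact {K L C : Set ℝ} (hK : IsCompact K) (hL : IsCompact L)
    (hKn : K.Nonempty) (hLn : L.Nonempty)
    (h : ∀ x ∈ K, ∀ y ∈ L, x + y ∈ C) : volume K + volume L ≤ volume C := by
  obtain ⟨M, hM, hMmax⟩ := hK.exists_isGreatest hKn
  obtain ⟨m, hm, hmmin⟩ := hL.exists_isLeast hLn
  have h1 : volume ((fun x => x + m) '' K) = volume K := by
    rw [Set.image_add_right]; exact measure_preimage_add_right _ _ _
  have h2 : volume ((fun x => M + x) '' L) = volume L := by
    rw [Set.image_add_left]; exact measure_preimage_add _ _ _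
  have hint : volume (((fun x => x + m) '' K) ∩ ((fun x => M + x) '' L)) = 0 := by
    refine measure_mono_null (t := {M + m}) ?_ (by simp)
    rintro z ⟨⟨x, hx, rfl⟩, ⟨y, hy, hxy⟩⟩
    have := hMmax hx
    have := hmmin hy
    simp only [Set.mem_singleton_iff] at *
    linarith
  have hmeas : MeasurableSet ((fun x => M + x) '' L) :=
    (hL.image (by fun_prop)).measurableSet
  rw [← h1, ← h2, ← measure_union_add_inter _ hmeas, hint, add_zero]
  apply measure_mono
  rintro z (⟨x, hx, rfl⟩ | ⟨y, hy, rfl⟩)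
  · exact h x hx m hm
  · exact h M hM y hy

/-- One-dimensional Brunn–Minkowski. -/
lemma bm {A B C : Set ℝ} (hA : MeasurableSet A) (hB : MeasurableSet B)
    (hAn : A.Nonempty) (hBn : B.Nonempty)
    (h : ∀ x ∈ A, ∀ y ∈ B, x + y ∈ C) : volume A + volume B ≤ volume C := by
  obtain ⟨x0, hx0⟩ := hAn
  obtain ⟨y0, hy0⟩ := hBn
  rw [hA.measure_eq_iSup_isCompact, hB.measure_eq_iSup_isCompact]
  simp only [iSup_and']
  refine ENNReal.biSup_add_biSup_le' ⟨∅, by simp, isCompact_empty⟩ ⟨∅, by simp, isCompact_empty⟩ ?_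
  rintro K ⟨hK, hKc⟩ L ⟨hL, hLc⟩
  refine le_trans (add_le_add (measure_mono (Set.subset_insert x0 K))
    (measure_mono (Set.subset_insert y0 L))) ?_
  refine bm_compact (hKc.insert x0) (hLc.insert y0) (Set.insert_nonempty _ _)
    (Set.insert_nonempty _ _) ?_
  intro x hx y hy
  exact h x (Set.insert_subset hx0 hK hx) y (Set.insert_subset hy0 hL hy)

lemma bm_smul {A B C : Set ℝ} {a b : ℝ} (ha : 0 < a) (hb : 0 < b)
    (hA : MeasurableSet A) (hB : MeasurableSet B)
    (hAn : A.Nonempty) (hBn : B.Nonempty)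
    (h : ∀ x ∈ A, ∀ y ∈ B, a * x + b * y ∈ C) :
    ENNReal.ofReal a * volume A + ENNReal.ofReal b * volume B ≤ volume C := by
  have h1 : volume (a • A) = ENNReal.ofReal a * volume A := by
    rw [Measure.addHaar_smul]; simp [abs_of_pos ha]
  have h2 : volume (b • B) = ENNReal.ofReal b * volume B := by
    rw [Measure.addHaar_smul]; simp [abs_of_pos hb]
  rw [← h1, ← h2]
  refine bm (hA.const_smul₀ a) (hB.const_smul₀ b) hAn.smul_set hBn.smul_set ?_
  rintro _ ⟨x, hx, rfl⟩ _ ⟨y, hy, rfl⟩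
  exact h x hx y hy

/-- Normalised one-dimensional inequality. -/
lemma pl_norm {f g h : ℝ → ℝ} (hf : Measurable f) (hg : Measurable g) (hh : Measurable h)
    (f0 : ∀ x, 0 ≤ f x) (g0 : ∀ x, 0 ≤ g x) (h0 : ∀ x, 0 ≤ h x)
    (f1 : ∀ x, f x ≤ 1) (g1 : ∀ x, g x ≤ 1)
    (fs : ∀ t < 1, ∃ x, t < f x) (gs : ∀ t < 1, ∃ x, t < g x)
    {a b : ℝ} (ha : 0 < a) (hb : 0 < b) (hab : a + b = 1)
    (H : ∀ x y, f x ^ a * g y ^ b ≤ h (a * x + b * y)) :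
    ENNReal.ofReal a * (∫⁻ x, ENNReal.ofReal (f x)) + ENNReal.ofReal b * (∫⁻ x, ENNReal.ofReal (g x))
      ≤ ∫⁻ x, ENNReal.ofReal (h x) := by
  rw [lintegral_eq_lintegral_meas_lt volume (Filter.Eventually.of_forall f0) hf.aemeasurable,
    lintegral_eq_lintegral_meas_lt volume (Filter.Eventually.of_forall g0) hg.aemeasurable,
    lintegral_eq_lintegral_meas_lt volume (Filter.Eventually.of_forall h0) hh.aemeasurable]
  have mono : ∀ u : ℝ → ℝ, Measurable fun t : ℝ => volume {x | t < u x} := fun u =>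
    Antitone.measurable (fun s t hst => measure_mono fun x hx => lt_of_le_of_lt hst hx)
  rw [← lintegral_const_mul _ (mono f), ← lintegral_const_mul _ (mono g),
    ← lintegral_add_left ((mono f).const_mul _)]
  refine setLIntegral_mono' measurableSet_Ioi ?_
  intro t ht
  have ht : 0 < t := ht
  by_cases h1 : t < 1
  · refine bm_smul ha hb (measurableSet_lt measurable_const hf)
      (measurableSet_lt measurable_const hg) (fs t h1) (gs t h1) ?_
    intro x hx y hy
    have hx : t < f x := hx
    have hy : t < g y := hy
    refine lt_of_lt_of_le ?_ (H x y)
    calc t = t ^ a * t ^ b := by rw [← Real.rpow_add ht, hab, Real.rpow_one]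
      _ < f x ^ a * g y ^ b := by
        apply mul_lt_mul'' (Real.rpow_lt_rpow ht.le hx ha) (Real.rpow_lt_rpow ht.le hy hb)
          <;> positivity
  · have e1 : {x | t < f x} = ∅ := by
      ext x; simp; linarith [f1 x]
    have e2 : {x | t < g x} = ∅ := by
      ext x; simp; linarith [g1 x]
    simp [e1, e2]

lemma amgm (x y : ℝ≥0∞) {a b : ℝ} (ha : 0 < a) (hb : 0 < b) (hab : a + b = 1) :
    x ^ a * y ^ b ≤ ENNReal.ofReal a * x + ENNReal.ofReal b * y := by
  have ha' : ENNReal.ofReal a ≠ 0 := by simpa using ha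
  have hb' : ENNReal.ofReal b ≠ 0 := by simpa using hb
  by_cases hx : x = ⊤
  · rw [hx, ENNReal.mul_top ha']; simp
  by_cases hy : y = ⊤
  · rw [hy, ENNReal.mul_top hb']; simp
  rw [← ENNReal.ofReal_toReal hx, ← ENNReal.ofReal_toReal hy,
    ENNReal.ofReal_rpow_of_nonneg ENNReal.toReal_nonneg ha.le,
    ENNReal.ofReal_rpow_of_nonneg ENNReal.toReal_nonneg hb.le,
    ← ENNReal.ofReal_mul (by positivity), ← ENNReal.ofReal_mul ha.le, ← ENNReal.ofReal_mul hb.le,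
    ← ENNReal.ofReal_add (by positivity) (by positivity)]
  exact ENNReal.ofReal_le_ofReal (Real.geom_mean_le_arith_mean2_weighted ha.le hb.le
    ENNReal.toReal_nonneg ENNReal.toReal_nonneg hab)

/-- `ENNReal` version with normalised suprema. -/
lemma pl_norm' {f g h : ℝ → ℝ≥0∞} (hf : Measurable f) (hg : Measurable g) (hh : Measurable h)
    (fs : ⨆ x, f x = 1) (gs : ⨆ x, g x = 1)
    {a b : ℝ} (ha : 0 < a) (hb : 0 < b) (hab : a + b = 1)
    (H : ∀ x y, f x ^ a * g y ^ b ≤ h (a * x + b * y)) :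
    (∫⁻ x, f x) ^ a * (∫⁻ x, g x) ^ b ≤ ∫⁻ x, h x := by
  refine (amgm _ _ ha hb hab).trans ?_
  have f1 : ∀ x, f x ≤ 1 := fun x => fs ▸ le_iSup f x
  have g1 : ∀ x, g x ≤ 1 := fun x => gs ▸ le_iSup g x
  have ft : ∀ x, f x ≠ ⊤ := fun x => ((f1 x).trans_lt ENNReal.one_lt_top).ne
  have gt : ∀ x, g x ≠ ⊤ := fun x => ((g1 x).trans_lt ENNReal.one_lt_top).ne
  have ht : ∀ x, min (h x) 1 ≠ ⊤ := fun x => ((min_le_right _ _).trans_lt ENNReal.one_lt_top).ne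
  have key := pl_norm (f := fun x => (f x).toReal) (g := fun x => (g x).toReal)
    (h := fun x => (min (h x) 1).toReal) hf.ennreal_toReal hg.ennreal_toReal
    (hh.min measurable_const).ennreal_toReal
    (fun _ => ENNReal.toReal_nonneg) (fun _ => ENNReal.toReal_nonneg)
    (fun _ => ENNReal.toReal_nonneg)
    (fun x => by simpa using ENNReal.toReal_mono ENNReal.one_ne_top (f1 x))
    (fun x => by simpa using ENNReal.toReal_mono ENNReal.one_ne_top (g1 x))
    (fun t ht => by
      have : ENNReal.ofReal t < ⨆ x, f x := by rw [fs]; simpa using ht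
      obtain ⟨x, hx⟩ := lt_iSup_iff.1 this
      exact ⟨x, (ENNReal.ofReal_lt_ofReal_iff'.1 (by rwa [ENNReal.ofReal_toReal (ft x)])).1⟩)
    (fun t ht => by
      have : ENNReal.ofReal t < ⨆ x, g x := by rw [gs]; simpa using ht
      obtain ⟨x, hx⟩ := lt_iSup_iff.1 this
      exact ⟨x, (ENNReal.ofReal_lt_ofReal_iff'.1 (by rwa [ENNReal.ofReal_toReal (gt x)])).1⟩)
    ha hb hab
    (fun x y => by
      rw [ENNReal.toReal_rpow, ENNReal.toReal_rpow, ← ENNReal.toReal_mul]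
      refine ENNReal.toReal_mono (ht _) (le_min (H x y) ?_)
      exact mul_le_one' (ENNReal.rpow_le_one (f1 x) ha.le) (ENNReal.rpow_le_one (g1 y) hb.le))
  simp only [ENNReal.ofReal_toReal (ft _), ENNReal.ofReal_toReal (gt _),
    ENNReal.ofReal_toReal (ht _)] at key
  exact key.trans (lintegral_mono fun x => min_le_left _ _)

/-- The Prékopa–Leindler property of a space. -/
def PL (E : Type) [AddCommGroup E] [Module ℝ E] [MeasureSpace E] : Prop :=
  ∀ f g h : E → ℝ≥0∞, Measurable f → Measurable g → Measurable h →
    ∀ a b : ℝ, 0 < a → 0 < b → a + b = 1 →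
    (∀ x y, f x ^ a * g y ^ b ≤ h (a • x + b • y)) →
    (∫⁻ x, f x) ^ a * (∫⁻ x, g x) ^ b ≤ ∫⁻ x, h x

lemma pl_bdd {f g h : ℝ → ℝ≥0∞} (hf : Measurable f) (hg : Measurable g) (hh : Measurable h)
    (fs : ⨆ x, f x ≠ ⊤) (gs : ⨆ x, g x ≠ ⊤)
    {a b : ℝ} (ha : 0 < a) (hb : 0 < b) (hab : a + b = 1)
    (H : ∀ x y, f x ^ a * g y ^ b ≤ h (a * x + b * y)) :
    (∫⁻ x, f x) ^ a * (∫⁻ x, g x) ^ b ≤ ∫⁻ x, h x := by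
  set M := ⨆ x, f x with hM
  set N := ⨆ x, g x with hN
  by_cases M0 : M = 0
  · have : ∀ x, f x = 0 := fun x => le_antisymm (M0 ▸ le_iSup f x) bot_le
    simp [this, ha]
  by_cases N0 : N = 0
  · have : ∀ x, g x = 0 := fun x => le_antisymm (N0 ▸ le_iSup g x) bot_le
    simp [this, hb]
  have Ma0 : M ^ a ≠ 0 := by simp [ENNReal.rpow_eq_zero_iff, M0, fs]
  have Mat : M ^ a ≠ ⊤ := ENNReal.rpow_ne_top_of_nonneg ha.le fs
  have Nb0 : N ^ b ≠ 0 := by simp [ENNReal.rpow_eq_zero_iff, N0, gs]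
  have Nbt : N ^ b ≠ ⊤ := ENNReal.rpow_ne_top_of_nonneg hb.le gs
  have key := pl_norm' (f := fun x => M⁻¹ * f x) (g := fun x => N⁻¹ * g x)
    (h := fun x => ((M ^ a)⁻¹ * (N ^ b)⁻¹) * h x)
    (hf.const_mul _) (hg.const_mul _) (hh.const_mul _)
    (by rw [← ENNReal.mul_iSup, ← hM, ENNReal.inv_mul_cancel M0 fs])
    (by rw [← ENNReal.mul_iSup, ← hN, ENNReal.inv_mul_cancel N0 gs]) ha hb hab
    (fun x y => by
      rw [ENNReal.mul_rpow_of_nonneg _ _ ha.le, ENNReal.mul_rpow_of_nonneg _ _ hb.le,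
        ENNReal.inv_rpow, ENNReal.inv_rpow, mul_mul_mul_comm]
      gcongr
      exact H x y)
  rw [lintegral_const_mul _ hf, lintegral_const_mul _ hg, lintegral_const_mul _ hh,
    ENNReal.mul_rpow_of_nonneg _ _ ha.le, ENNReal.mul_rpow_of_nonneg _ _ hb.le,
    ENNReal.inv_rpow, ENNReal.inv_rpow, mul_mul_mul_comm] at key
  refine (ENNReal.mul_le_mul_iff_right ?_ ?_).1 key
  · simp [Mat, Nbt]
  · exact ENNReal.mul_ne_top (by simpa using Ma0) (by simpa using Nb0)

lemma tendsto_trunc {f : ℝ → ℝ≥0∞} (hf : Measurable f) :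
    Filter.Tendsto (fun n : ℕ => ∫⁻ x, min (f x) n) Filter.atTop (nhds (∫⁻ x, f x)) := by
  refine lintegral_tendsto_of_tendsto_of_monotone
    (fun n => (hf.min measurable_const).aemeasurable) ?_ ?_
  · refine Filter.Eventually.of_forall fun x m n hmn => ?_
    exact min_le_min le_rfl (by exact_mod_cast hmn)
  · refine Filter.Eventually.of_forall fun x => ?_
    have := (tendsto_const_nhds (x := f x)).min ENNReal.tendsto_nat_nhds_top
    simpa using this

lemma pl_real : PL ℝ := by
  intro f g h hf hg hh a b ha hb hab H
  by_cases f0 : ∫⁻ x, f x = 0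
  · simp [f0, ha]
  by_cases g0 : ∫⁻ x, g x = 0
  · simp [g0, hb]
  have T1 := (ENNReal.continuous_rpow_const (y := a)).continuousAt.tendsto.comp (tendsto_trunc hf)
  have T2 := (ENNReal.continuous_rpow_const (y := b)).continuousAt.tendsto.comp (tendsto_trunc hg)
  have T := ENNReal.Tendsto.mul T1 (Or.inl (by simp [ENNReal.rpow_eq_zero_iff, f0, ha.le]))
    T2 (Or.inl (by simp [ENNReal.rpow_eq_zero_iff, g0, hb.le]))
  refine le_of_tendsto' T fun n => ?_
  refine pl_bdd (hf.min measurable_const) (hg.min measurable_const) hh ?_ ?_ ha hb hab ?_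
  · exact ((iSup_le fun x => min_le_right _ _).trans_lt (ENNReal.natCast_lt_top n)).ne
  · exact ((iSup_le fun x => min_le_right _ _).trans_lt (ENNReal.natCast_lt_top n)).ne
  · intro x y
    refine le_trans ?_ (H x y)
    exact mul_le_mul' (ENNReal.rpow_le_rpow (min_le_left _ _) ha.le)
      (ENNReal.rpow_le_rpow (min_le_left _ _) hb.le)

lemma pl_prod {E F : Type} [AddCommGroup E] [Module ℝ E] [MeasureSpace E]
    [AddCommGroup F] [Module ℝ F] [MeasureSpace F] [SFinite (volume : Measure F)]
    (hE : PL E) (hF : PL F) : PL (E × F) := by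
  intro f g h hf hg hh a b ha hb hab H
  rw [Measure.volume_eq_prod, lintegral_prod _ hf.aemeasurable, lintegral_prod _ hg.aemeasurable,
    lintegral_prod _ hh.aemeasurable]
  refine hE _ _ _ hf.lintegral_prod_right' hg.lintegral_prod_right' hh.lintegral_prod_right'
    a b ha hb hab ?_
  intro x y
  refine hF _ _ _ (hf.comp measurable_prodMk_left) (hg.comp measurable_prodMk_left)
    (hh.comp measurable_prodMk_left) a b ha hb hab ?_
  intro z w
  exact H (x, z) (y, w)

lemma pl_transfer {E F : Type} [AddCommGroup E] [Module ℝ E] [MeasureSpace E]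
    [AddCommGroup F] [Module ℝ F] [MeasureSpace F] (hE : PL E)
    (e : E → F) (he : MeasurePreserving e volume volume)
    (hlin : ∀ (a b : ℝ) x y, e (a • x + b • y) = a • e x + b • e y) : PL F := by
  intro f g h hf hg hh a b ha hb hab H
  rw [← he.lintegral_comp hf, ← he.lintegral_comp hg, ← he.lintegral_comp hh]
  refine hE _ _ _ (hf.comp he.measurable) (hg.comp he.measurable) (hh.comp he.measurable)
    a b ha hb hab ?_
  intro x y
  simp only [Function.comp, hlin]
  exact H _ _

lemma pl_pi (n : ℕ) : PL (Fin n → ℝ) := by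
  induction n with
  | zero =>
    intro f g h hf hg hh a b ha hb hab H
    have hv : (volume : Measure (Fin 0 → ℝ)) Set.univ = 1 := by
      simp [volume_pi]
    simp only [lintegral_unique, hv, mul_one]
    convert H default default
  | succ n ih =>
    refine pl_transfer (pl_prod pl_real ih) _
      ((volume_preserving_piFinSuccAbove (fun _ : Fin (n + 1) => ℝ) 0).symm) ?_
    intro a b x y
    ext i
    refine Fin.cases ?_ (fun j => ?_) i <;>
      simp [MeasurableEquiv.piFinSuccAbove_symm_apply, Fin.insertNthEquiv]

lemma pl_euclidean (n : ℕ) : PL (EuclideanSpace ℝ (Fin n)) :=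
  pl_transfer (pl_pi n) _
    ((EuclideanSpace.volume_preserving_symm_measurableEquiv_toLp (Fin n)).symm) (by
      intro a b x y
      rfl)

/-- Only a.e. measurability of the majorant is needed. -/
lemma pl_ae {E : Type} [AddCommGroup E] [Module ℝ E] [MeasureSpace E] (hE : PL E)
    (f g h : E → ℝ≥0∞) (hh : AEMeasurable h volume) (a b : ℝ) (ha : 0 < a) (hb : 0 < b)
    (hab : a + b = 1) (H : ∀ x y, f x ^ a * g y ^ b ≤ h (a • x + b • y)) :
    (∫⁻ x, f x) ^ a * (∫⁻ x, g x) ^ b ≤ ∫⁻ x, h x := by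
  classical
  obtain ⟨f', mf, lf, ef⟩ := exists_measurable_le_lintegral_eq volume f
  obtain ⟨g', mg, lg, eg⟩ := exists_measurable_le_lintegral_eq volume g
  set S := toMeasurable volume {x | h x ≠ hh.mk h x} with hS
  have S0 : volume S = 0 := by
    rw [measure_toMeasurable]; exact hh.ae_eq_mk
  have mS : MeasurableSet S := measurableSet_toMeasurable _ _
  let h' : E → ℝ≥0∞ := S.piecewise (fun _ => ⊤) (hh.mk h)
  have mh' : Measurable h' := measurable_const.piecewise mS hh.measurable_mk
  have hle : ∀ x, h x ≤ h' x := by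
    intro x
    by_cases hx : x ∈ S
    · simp [h', hx]
    · have : h x = hh.mk h x := by
        by_contra hne
        exact hx (subset_toMeasurable _ _ hne)
      simp only [h', Set.piecewise, hx, if_false]
      exact this.le
  have heq : ∫⁻ x, h' x = ∫⁻ x, h x := by
    apply lintegral_congr_ae
    have : ∀ᵐ x, x ∉ S := measure_eq_zero_iff_ae_notMem.1 S0
    filter_upwards [this, hh.ae_eq_mk] with x hx hx2
    simp only [h', Set.piecewise, hx, if_false]
    exact hx2.symm
  rw [ef, eg, ← heq]
  refine hE f' g' h' mf mg mh' a b ha hb hab fun x y => le_trans ?_ ((H x y).trans (hle _))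
  exact mul_le_mul' (ENNReal.rpow_le_rpow (lf x) ha.le) (ENNReal.rpow_le_rpow (lg y) hb.le)

lemma norm_sq_convex {E : Type} [NormedAddCommGroup E] [NormedSpace ℝ E] (x y : E) {a b : ℝ}
    (ha : 0 ≤ a) (hb : 0 ≤ b) (hab : a + b = 1) :
    ‖a • x + b • y‖ ^ 2 ≤ a * ‖x‖ ^ 2 + b * ‖y‖ ^ 2 := by
  have h1 : ‖a • x + b • y‖ ≤ a * ‖x‖ + b * ‖y‖ := by
    refine (norm_add_le _ _).trans ?_
    rw [norm_smul, norm_smul, Real.norm_of_nonneg ha, Real.norm_of_nonneg hb]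
  have h2 : ‖a • x + b • y‖ ^ 2 ≤ (a * ‖x‖ + b * ‖y‖) ^ 2 :=
    pow_le_pow_left₀ (norm_nonneg _) h1 2
  have hb' : b = 1 - a := by linarith
  subst hb'
  nlinarith [mul_nonneg (mul_nonneg ha hb) (sq_nonneg (‖x‖ - ‖y‖))]

end PLaux

/-- If `g ≥ 0` is log-concave and integrable, then `P^ε g` is log-concave. -/
theorem stmt5 (d : ℕ) (ε : ℝ) (hε : 0 < ε) (g : EuclideanSpace ℝ (Fin d) → ℝ)
    (hg : LogConcaveFn g) (hgint : Integrable g (volume : Measure (EuclideanSpace ℝ (Fin d)))) :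
    LogConcaveFn (OU d ε g) := by
  obtain ⟨g0, hgc⟩ := hg
  have hs : 0 < 1 - Real.exp (-ε) := by
    have : Real.exp (-ε) < 1 := by
      simpa using hε
    linarith
  have hC : 0 ≤ (2 * π * (1 - Real.exp (-ε))) ^ (-(d : ℝ) / 2) := by positivity
  unfold OU
  generalize (2 * π * (1 - Real.exp (-ε))) ^ (-(d : ℝ) / 2) = C at hC
  generalize Real.exp (-ε / 2) = c
  generalize 1 - Real.exp (-ε) = s at hs
  set F : EuclideanSpace ℝ (Fin d) → EuclideanSpace ℝ (Fin d) → ℝ :=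
    fun x y => g (y + c • x) * Real.exp (-‖y‖ ^ 2 / (2 * s)) with hF
  have F0 : ∀ x y, 0 ≤ F x y := fun x y => mul_nonneg (g0 _) (Real.exp_pos _).le
  have Fi : ∀ x, Integrable (F x) := by
    intro x
    refine (hgint.comp_add_right (c • x)).mul_bdd (c := 1) ?_ ?_
    · exact Continuous.aestronglyMeasurable (by fun_prop)
    · refine Filter.Eventually.of_forall fun y => ?_
      rw [Real.norm_of_nonneg (Real.exp_pos _).le]
      refine Real.exp_le_one_iff.2 ?_
      exact div_nonpos_of_nonpos_of_nonneg (by nlinarith [sq_nonneg ‖y‖]) (by positivity)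
  have I0 : ∀ x, 0 ≤ ∫ y, F x y := fun x => integral_nonneg (F0 x)
  refine ⟨fun x => mul_nonneg hC (I0 x), ?_⟩
  intro x y a b ha hb hab
  rcases ha.eq_or_lt with rfl | ha
  · obtain rfl : b = 1 := by linarith
    simp
  rcases hb.eq_or_lt with rfl | hb
  · obtain rfl : a = 1 := by linarith
    simp
  have hCC : C ^ a * C ^ b = C := by
    rw [← Real.rpow_add_of_nonneg hC ha.le hb.le, hab, Real.rpow_one]
  have key : (∫ z, F x z) ^ a * (∫ z, F y z) ^ b ≤ ∫ z, F (a • x + b • y) z := by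
    rw [← ENNReal.ofReal_le_ofReal_iff (I0 _),
      ENNReal.ofReal_mul (Real.rpow_nonneg (I0 _) _),
      ← ENNReal.ofReal_rpow_of_nonneg (I0 _) ha.le, ← ENNReal.ofReal_rpow_of_nonneg (I0 _) hb.le,
      ofReal_integral_eq_lintegral_ofReal (Fi _) (Filter.Eventually.of_forall (F0 _)),
      ofReal_integral_eq_lintegral_ofReal (Fi _) (Filter.Eventually.of_forall (F0 _)),
      ofReal_integral_eq_lintegral_ofReal (Fi _) (Filter.Eventually.of_forall (F0 _))]
    refine PLaux.pl_ae (PLaux.pl_euclidean d) _ _ _ (Fi _).aemeasurable.ennreal_ofReal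
      a b ha hb hab ?_
    intro u v
    rw [ENNReal.ofReal_rpow_of_nonneg (F0 _ _) ha.le, ENNReal.ofReal_rpow_of_nonneg (F0 _ _) hb.le,
      ← ENNReal.ofReal_mul (Real.rpow_nonneg (F0 _ _) _)]
    refine ENNReal.ofReal_le_ofReal ?_
    simp only [hF]
    rw [Real.mul_rpow (g0 _) (Real.exp_pos _).le, Real.mul_rpow (g0 _) (Real.exp_pos _).le,
      mul_mul_mul_comm]
    refine mul_le_mul ?_ ?_ (by positivity) (g0 _)
    · refine (hgc _ _ a b ha.le hb.le hab).trans (le_of_eq ?_)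
      congr 1
      module
    · rw [← Real.exp_mul, ← Real.exp_mul, ← Real.exp_add]
      refine Real.exp_le_exp.2 ?_
      have h1 := PLaux.norm_sq_convex u v ha.le hb.le hab
      have : -‖u‖ ^ 2 / (2 * s) * a + -‖v‖ ^ 2 / (2 * s) * b
          = -(a * ‖u‖ ^ 2 + b * ‖v‖ ^ 2) / (2 * s) := by ring
      rw [this]
      gcongr
  rw [Real.mul_rpow hC (I0 x), Real.mul_rpow hC (I0 y), mul_mul_mul_comm, hCC]
  exact mul_le_mul_of_nonneg_left key hC
end

section
/- Let $V:\mathbb{R}^d \to \mathbb{R}$ and $W:\mathbb{R}^d \to \mathbb{R}\cup\{+\infty\}$ be convex, and let $\Phi^\varepsilon(h) = V - \log P^\varepsilon(e^{-W}/P^\varepsilon(e^h))$ where $P^\varepsilon$ is the Ornstein–Uhlenbeck semigroup. If $h:\mathbb{R}^d \to \mathbb{R}\cup\{+\infty\}$ is convex, then $\Phi^\varepsilon(h)$ is convex. -/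
open MeasureTheory Real

/-- Log-concavity for extended nonnegative functions. -/
def LCE {E : Type*} [AddCommGroup E] [Module ℝ E] (f : E → ENNReal) : Prop :=
  ∀ x y : E, ∀ a b : ℝ, 0 < a → 0 < b → a + b = 1 → f x ^ a * f y ^ b ≤ f (a • x + b • y)

lemma amgm_ennreal (X Y : ENNReal) (a b : ℝ) (ha : 0 < a) (hb : 0 < b) (hab : a + b = 1) :
    X ^ a * Y ^ b ≤ ENNReal.ofReal a * X + ENNReal.ofReal b * Y := by
  by_cases hX : X = ⊤
  · subst hX
    rw [ENNReal.mul_top (by simpa using ha)]; simp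
  by_cases hY : Y = ⊤
  · subst hY
    rw [ENNReal.mul_top (by simpa using hb)]; simp
  lift X to NNReal using hX
  lift Y to NNReal using hY
  have := NNReal.geom_mean_le_arith_mean2_weighted a.toNNReal b.toNNReal X Y
    (by rw [← Real.toNNReal_add ha.le hb.le, hab]; simp)
  rw [Real.coe_toNNReal _ ha.le, Real.coe_toNNReal _ hb.le] at this
  rw [← ENNReal.coe_rpow_of_nonneg _ ha.le, ← ENNReal.coe_rpow_of_nonneg _ hb.le]
  unfold ENNReal.ofReal
  exact_mod_cast this

lemma bm_compact (K L : Set ℝ) (hK : IsCompact K) (hL : IsCompact L) (hK0 : K.Nonempty)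
    (hL0 : L.Nonempty) (C : Set ℝ) (hC : ∀ x ∈ K, ∀ y ∈ L, x + y ∈ C) :
    volume K + volume L ≤ volume C := by
  have h1 := hK.sSup_mem hK0
  have h2 := hL.sInf_mem hL0
  set k := sSup K
  set l := sInf L
  have e1 : volume (Set.image (fun x => x + l) K) = volume K := by simp
  have e2 : volume (Set.image (fun x => k + x) L) = volume L := by simp
  rw [← e1, ← e2, ← measure_union₀]
  · apply measure_mono
    rintro _ (⟨x, hx, rfl⟩ | ⟨x, hx, rfl⟩)
    · exact hC _ hx _ h2
    · exact hC _ h1 _ hx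
  · exact (hL.image (by fun_prop)).measurableSet.nullMeasurableSet
  · refine measure_mono_null (t := {k + l}) ?_ (by simp)
    rintro _ ⟨⟨x, hx, rfl⟩, ⟨y, hy, h⟩⟩
    have := le_csSup hK.bddAbove hx
    have := csInf_le hL.bddBelow hy
    simp only [Set.mem_singleton_iff] at *
    linarith

lemma bm_meas (A B : Set ℝ) (hA : MeasurableSet A) (hB : MeasurableSet B) (hA0 : A.Nonempty)
    (hB0 : B.Nonempty) (C : Set ℝ) (hC : ∀ x ∈ A, ∀ y ∈ B, x + y ∈ C) :
    volume A + volume B ≤ volume C := by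
  obtain ⟨p, hp⟩ := hA0
  obtain ⟨q, hq⟩ := hB0
  rw [hA.measure_eq_iSup_isCompact, hB.measure_eq_iSup_isCompact]
  simp only [iSup_and']
  refine ENNReal.biSup_add_biSup_le' (p := fun K => K ⊆ A ∧ IsCompact K)
    (q := fun K => K ⊆ B ∧ IsCompact K) ⟨∅, by simp⟩ ⟨∅, by simp⟩ ?_
  rintro K ⟨hKA, hK⟩ L ⟨hLB, hL⟩
  refine le_trans ?_ (bm_compact (insert p K) (insert q L) (hK.insert _) (hL.insert _) (by simp)
    (by simp) C ?_)
  · gcongr <;> simp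
  · intro x hx y hy
    exact hC x (Set.insert_subset hp hKA hx) y (Set.insert_subset hq hLB hy)

open Pointwise in
lemma bm_weighted (A B : Set ℝ) (hA : MeasurableSet A) (hB : MeasurableSet B) (hA0 : A.Nonempty)
    (hB0 : B.Nonempty) (C : Set ℝ) (a b : ℝ) (ha : 0 < a) (hb : 0 < b)
    (hC : ∀ x ∈ A, ∀ y ∈ B, a * x + b * y ∈ C) :
    ENNReal.ofReal a * volume A + ENNReal.ofReal b * volume B ≤ volume C := by
  have := bm_meas (a • A) (b • B) (hA.const_smul₀ a) (hB.const_smul₀ b) hA0.smul_set hB0.smul_set C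
    (by
      rintro _ ⟨x, hx, rfl⟩ _ ⟨y, hy, rfl⟩
      exact hC x hx y hy)
  simpa [Measure.addHaar_smul, abs_of_pos ha, abs_of_pos hb] using this

lemma pl_norm (f g h : ℝ → ℝ) (hf : Measurable f) (hg : Measurable g) (hh : Measurable h)
    (f0 : ∀ x, 0 ≤ f x) (g0 : ∀ x, 0 ≤ g x) (h0 : ∀ x, 0 ≤ h x)
    (f1 : ∀ x, f x ≤ 1) (g1 : ∀ x, g x ≤ 1)
    (f2 : ∀ s < 1, ∃ x, s < f x) (g2 : ∀ s < 1, ∃ x, s < g x)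
    (a b : ℝ) (ha : 0 < a) (hb : 0 < b) (hab : a + b = 1)
    (H : ∀ x y, f x ^ a * g y ^ b ≤ h (a * x + b * y)) :
    (∫⁻ x, ENNReal.ofReal (f x)) ^ a * (∫⁻ x, ENNReal.ofReal (g x)) ^ b ≤
      ∫⁻ x, ENNReal.ofReal (h x) := by
  refine (amgm_ennreal _ _ a b ha hb hab).trans ?_
  rw [lintegral_eq_lintegral_meas_lt volume (.of_forall f0) hf.aemeasurable,
    lintegral_eq_lintegral_meas_lt volume (.of_forall g0) hg.aemeasurable,
    lintegral_eq_lintegral_meas_lt volume (.of_forall h0) hh.aemeasurable,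
    ← lintegral_const_mul' _ _ (by simp), ← lintegral_const_mul' _ _ (by simp)]
  refine (le_lintegral_add _ _).trans ?_
  refine setLIntegral_mono' measurableSet_Ioi ?_
  intro s hs
  have hs : 0 < s := hs
  by_cases hs1 : s < 1
  · apply bm_weighted _ _ (measurableSet_lt measurable_const hf)
      (measurableSet_lt measurable_const hg) (f2 s hs1) (g2 s hs1) _ a b ha hb
    intro x hx y hy
    have hx : s < f x := hx
    have hy : s < g y := hy
    refine lt_of_lt_of_le ?_ (H x y)
    calc s = s ^ a * s ^ b := by rw [← Real.rpow_add hs, hab, Real.rpow_one]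
      _ < _ := by
        apply mul_lt_mul'' (Real.rpow_lt_rpow hs.le hx ha) (Real.rpow_lt_rpow hs.le hy hb) <;>
        positivity
  · have e1 : {x | s < f x} = ∅ := by
      ext x; simpa using (f1 x).trans (not_lt.1 hs1)
    have e2 : {x | s < g x} = ∅ := by
      ext x; simpa using (g1 x).trans (not_lt.1 hs1)
    simp [e1, e2]

lemma pl_bdd (f g h : ℝ → ℝ) (hf : Measurable f) (hg : Measurable g) (hh : Measurable h)
    (f0 : ∀ x, 0 ≤ f x) (g0 : ∀ x, 0 ≤ g x) (h0 : ∀ x, 0 ≤ h x)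
    (c : ℝ) (f1 : ∀ x, f x ≤ c) (g1 : ∀ x, g x ≤ c)
    (a b : ℝ) (ha : 0 < a) (hb : 0 < b) (hab : a + b = 1)
    (H : ∀ x y, f x ^ a * g y ^ b ≤ h (a * x + b * y)) :
    (∫⁻ x, ENNReal.ofReal (f x)) ^ a * (∫⁻ x, ENNReal.ofReal (g x)) ^ b ≤
      ∫⁻ x, ENNReal.ofReal (h x) := by
  have key : ∀ f : ℝ → ℝ, (∀ x, 0 ≤ f x) → (∀ x, f x ≤ c) → (∀ x, f x = 0) ∨
      ∃ M > 0, (∀ x, f x / M ≤ 1) ∧ ∀ s < 1, ∃ x, s < f x / M := by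
    intro f f0 f1
    have hb : BddAbove (Set.range f) := ⟨c, by rintro _ ⟨x, rfl⟩; exact f1 x⟩
    by_cases hz : ∀ x, f x = 0
    · exact .inl hz
    push Not at hz
    obtain ⟨x, hx⟩ := hz
    have hM : 0 < ⨆ x, f x := lt_of_lt_of_le (lt_of_le_of_ne (f0 x) hx.symm) (le_ciSup hb x)
    refine .inr ⟨⨆ x, f x, hM, fun x => ?_, fun s hs => ?_⟩
    · rw [div_le_one hM]; exact le_ciSup hb x
    · obtain ⟨x, hx⟩ := exists_lt_of_lt_ciSup (show s * (⨆ x, f x) < ⨆ x, f x by nlinarith)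
      exact ⟨x, by rwa [lt_div_iff₀ hM]⟩
  rcases key f f0 f1 with hz | ⟨M, hM, hM1, hM2⟩
  · simp [hz, ha]
  rcases key g g0 g1 with hz | ⟨N, hN, hN1, hN2⟩
  · simp [hz, hb]
  have hMN : 0 < M ^ a * N ^ b := by positivity
  have := pl_norm (fun x => f x / M) (fun x => g x / N) (fun x => h x / (M ^ a * N ^ b))
    (by fun_prop) (by fun_prop) (by fun_prop) (fun x => div_nonneg (f0 x) hM.le)
    (fun x => div_nonneg (g0 x) hN.le) (fun x => div_nonneg (h0 x) hMN.le) hM1 hN1 hM2 hN2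
    a b ha hb hab (by
      intro x y
      rw [Real.div_rpow (f0 x) hM.le, Real.div_rpow (g0 y) hN.le, div_mul_div_comm]
      gcongr
      exact H x y)
  have hd : ∀ (f : ℝ → ℝ) (M : ℝ), 0 < M → ∫⁻ x, ENNReal.ofReal (f x / M) =
      ENNReal.ofReal M⁻¹ * ∫⁻ x, ENNReal.ofReal (f x) := by
    intro f M hM
    rw [← lintegral_const_mul' _ _ (by simp)]
    congr 1; ext x
    rw [← ENNReal.ofReal_mul (by positivity), mul_comm, div_eq_mul_inv]
  rw [hd _ _ hM, hd _ _ hN, hd _ _ hMN, ENNReal.mul_rpow_of_nonneg _ _ ha.le,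
    ENNReal.mul_rpow_of_nonneg _ _ hb.le, mul_mul_mul_comm,
    ENNReal.ofReal_rpow_of_pos (by positivity), ENNReal.ofReal_rpow_of_pos (by positivity),
    ← ENNReal.ofReal_mul (by positivity), Real.inv_rpow hM.le, Real.inv_rpow hN.le,
    ← mul_inv] at this
  refine (ENNReal.mul_le_mul_iff_right ?_ ?_).1 this
  · exact (ENNReal.ofReal_pos.2 (inv_pos.2 hMN)).ne'
  · simp

lemma pl_ennreal (f g h : ℝ → ENNReal) (hf : Measurable f) (hg : Measurable g) (hh : Measurable h)
    (a b : ℝ) (ha : 0 < a) (hb : 0 < b) (hab : a + b = 1)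
    (H : ∀ x y, f x ^ a * g y ^ b ≤ h (a * x + b * y)) :
    (∫⁻ x, f x) ^ a * (∫⁻ x, g x) ^ b ≤ ∫⁻ x, h x := by
  have trunc : ∀ n : ℕ, (∫⁻ x, min (f x) n) ^ a * (∫⁻ x, min (g x) n) ^ b ≤ ∫⁻ x, h x := by
    intro n
    have hfin : ∀ X : ENNReal, min X (n : ENNReal) ≠ ⊤ := fun X =>
      ne_top_of_le_ne_top (ENNReal.natCast_ne_top n) (min_le_right _ _)
    have e : ∀ X : ENNReal, ENNReal.ofReal (min X (n : ENNReal)).toReal = min X n := fun X =>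
      ENNReal.ofReal_toReal (hfin X)
    have hle : ∀ X : ENNReal, (min X (n : ENNReal)).toReal ≤ n := fun X => by
      have := ENNReal.toReal_mono (ENNReal.natCast_ne_top n) (min_le_right X (n : ENNReal))
      simpa using this
    have := pl_bdd (fun x => (min (f x) n).toReal) (fun x => (min (g x) n).toReal)
      (fun x => (min (h x) n).toReal) (by fun_prop) (by fun_prop) (by fun_prop)
      (fun _ => ENNReal.toReal_nonneg) (fun _ => ENNReal.toReal_nonneg)
      (fun _ => ENNReal.toReal_nonneg) n (fun _ => hle _) (fun _ => hle _) a b ha hb hab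
      (by
        intro x y
        rw [ENNReal.toReal_rpow, ENNReal.toReal_rpow, ← ENNReal.toReal_mul]
        refine ENNReal.toReal_mono (hfin _) (le_min ?_ ?_)
        · refine le_trans ?_ (H x y)
          gcongr <;> exact min_le_left _ _
        · calc _ ≤ (n : ENNReal) ^ a * (n : ENNReal) ^ b := by
                gcongr <;> exact min_le_right _ _
            _ = n := by rw [← ENNReal.rpow_add_of_nonneg _ _ ha.le hb.le, hab, ENNReal.rpow_one])
    simp only [e] at this
    exact this.trans (lintegral_mono fun x => min_le_left _ _)
  have lim : ∀ f : ℝ → ENNReal, Measurable f →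
      Filter.Tendsto (fun n : ℕ => ∫⁻ x, min (f x) n) Filter.atTop (nhds (∫⁻ x, f x)) := by
    intro f hf
    refine lintegral_tendsto_of_tendsto_of_monotone (fun n => by fun_prop) ?_ ?_
    · refine .of_forall fun x m n hmn => ?_
      dsimp only
      gcongr
    · refine .of_forall fun x => ?_
      have := (tendsto_const_nhds (x := f x)).min ENNReal.tendsto_nat_nhds_top
      simpa using this
  refine ENNReal.mul_le_of_forall_lt fun u hu v hv => ?_
  have l1 := (ENNReal.continuous_rpow_const (y := a)).continuousAt.tendsto.comp (lim f hf)
  have l2 := (ENNReal.continuous_rpow_const (y := b)).continuousAt.tendsto.comp (lim g hg)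
  obtain ⟨n, hn1, hn2⟩ := ((l1.eventually (lt_mem_nhds hu)).and
    (l2.eventually (lt_mem_nhds hv))).exists
  exact (mul_le_mul' hn1.le hn2.le).trans (trunc n)

lemma prekopa_one {E : Type*} [AddCommGroup E] [Module ℝ E] [MeasurableSpace E]
    (F : E × ℝ → ENNReal) (hF : Measurable F) (hL : LCE F) :
    LCE (fun x => ∫⁻ t, F (x, t)) := by
  intro x y a b ha hb hab
  refine pl_ennreal _ _ _ (by fun_prop) (by fun_prop) (by fun_prop) a b ha hb hab ?_
  intro s t
  exact hL (x, s) (y, t) a b ha hb hab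

lemma prekopa {E : Type*} [AddCommGroup E] [Module ℝ E] [MeasurableSpace E] (n : ℕ)
    (F : E × (Fin n → ℝ) → ENNReal) (hF : Measurable F) (hL : LCE F) :
    LCE (fun x => ∫⁻ t, F (x, t)) := by
  induction n with
  | zero =>
    intro x y a b ha hb hab
    have : ∀ x : E, ∫⁻ t, F (x, t) = F (x, 0) := by
      intro x
      rw [lintegral_unique, volume_pi, Measure.pi_of_empty]
      simp; congr
    simp only [this]
    simpa using hL (x, 0) (y, 0) a b ha hb hab
  | succ n ih =>
    have hc : Measurable (fun p : (E × (Fin n → ℝ)) × ℝ =>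
        (p.1.1, (Fin.cons p.2 p.1.2 : Fin (n + 1) → ℝ))) := by
      refine Measurable.prodMk (by fun_prop) (measurable_pi_iff.2 fun i => ?_)
      refine Fin.cases ?_ (fun j => ?_) i
      · simpa using measurable_snd
      · simp only [Fin.cons_succ]; fun_prop
    have hG := hF.comp hc
    have h1 := prekopa_one _ hG (by
      intro p q a b ha hb hab
      refine (hL _ _ a b ha hb hab).trans (le_of_eq ?_)
      simp only [Function.comp]
      congr 1
      refine Prod.ext (by simp) ?_
      funext i
      refine Fin.cases ?_ (fun j => ?_) i <;> simp)
    have h2 := ih _ hG.lintegral_prod_right' h1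
    have : (fun x => ∫⁻ t, F (x, t)) = fun x => ∫⁻ w : Fin n → ℝ, ∫⁻ t : ℝ,
        F (x, (Fin.cons t w : Fin (n + 1) → ℝ)) := by
      ext x
      have mp := (volume_preserving_piFinSuccAbove (fun _ : Fin (n + 1) => ℝ) 0).symm
      rw [← mp.lintegral_comp (by fun_prop)]
      have hm : Measurable fun p : ℝ × (Fin n → ℝ) =>
          F (x, (Fin.cons p.1 p.2 : Fin (n + 1) → ℝ)) :=
        hG.comp (g := fun _ => _) (f := fun p : ℝ × (Fin n → ℝ) => ((x, p.2), p.1)) (by fun_prop)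
      rw [← lintegral_prod_symm _ hm.aemeasurable]
      refine lintegral_congr fun p => ?_
      change F (x, Fin.insertNth 0 p.1 p.2) = _
      rw [Fin.insertNth_zero']
    rw [this]
    exact h2

lemma convex_level {E : Type*} [AddCommGroup E] [Module ℝ E] (G : E → ENNReal) (hG : LCE G)
    (q : ENNReal) : Convex ℝ {x | q ≤ G x} := by
  rw [convex_iff_forall_pos]
  intro x hx y hy a b ha hb hab
  refine le_trans ?_ (hG x y a b ha hb hab)
  calc q = q ^ a * q ^ b := by
        rw [← ENNReal.rpow_add_of_nonneg _ _ ha.le hb.le, hab, ENNReal.rpow_one]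
    _ ≤ _ := by gcongr <;> assumption

/-- Upper semicontinuous hull. -/
noncomputable def hull {E : Type*} [TopologicalSpace E] (G : E → ENNReal) (x : E) : ENNReal :=
  Filter.limsup G (nhds x)

lemma le_hull {E : Type*} [TopologicalSpace E] (G : E → ENNReal) (x : E) : G x ≤ hull G x := by
  refine Filter.le_limsup_of_frequently_le ?_
  exact Filter.Frequently.filter_mono (f := pure x) (by simp) (pure_le_nhds x)

lemma hull_measurable {E : Type*} [TopologicalSpace E] [MeasurableSpace E] [BorelSpace E]
    (G : E → ENNReal) : Measurable (hull G) := by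
  apply UpperSemicontinuous.measurable
  intro x c hc
  obtain ⟨c', h1, h2⟩ := exists_between hc
  have := Filter.eventually_lt_of_limsup_lt h1
  filter_upwards [eventually_eventually_nhds.2 this] with y hy
  refine lt_of_le_of_lt ?_ h2
  exact Filter.limsup_le_of_le (h := hy.mono fun _ h => h.le)

lemma hull_lce {E : Type*} [TopologicalSpace E] [AddCommGroup E] [Module ℝ E] [ContinuousAdd E]
    [ContinuousSMul ℝ E] (G : E → ENNReal) (hG : LCE G) : LCE (hull G) := by
  intro x y a b ha hb hab
  have key : ∀ x : E, ∀ a : ℝ, 0 < a → ∀ u < hull G x ^ a, ∃ᶠ x' in nhds x, u < G x' ^ a := by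
    intro x a ha u hu
    have : u ^ a⁻¹ < hull G x := by
      rwa [ENNReal.rpow_inv_lt_iff ha]
    refine (Filter.frequently_lt_of_lt_limsup (h := this)).mono fun x' h => ?_
    rwa [← ENNReal.rpow_inv_lt_iff ha]
  refine ENNReal.mul_le_of_forall_lt fun u hu v hv => ?_
  refine Filter.le_limsup_of_frequently_le ?_
  rw [Filter.frequently_iff]
  intro U hU
  have hc : Filter.Tendsto (fun p : E × E => a • p.1 + b • p.2) (nhds x ×ˢ nhds y)
      (nhds (a • x + b • y)) := by
    rw [← nhds_prod_eq]
    exact Continuous.tendsto (f := fun p : E × E => a • p.1 + b • p.2) (by fun_prop) (x, y)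
  obtain ⟨S, hS, T, hT, hST⟩ := Filter.mem_prod_iff.1 (hc hU)
  obtain ⟨p, hp, hpS⟩ := ((key x a ha u hu).and_eventually hS).exists
  obtain ⟨q, hq, hqT⟩ := ((key y b hb v hv).and_eventually hT).exists
  exact ⟨_, hST (Set.mk_mem_prod hpS hqT),
    (mul_le_mul' hp.le hq.le).trans (hG p q a b ha hb hab)⟩

lemma hull_ae {E : Type*} [NormedAddCommGroup E] [NormedSpace ℝ E] [FiniteDimensional ℝ E]
    [MeasurableSpace E] [BorelSpace E] (μ : Measure E) [μ.IsAddHaarMeasure]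
    (G : E → ENNReal) (hG : LCE G) : hull G =ᵐ[μ] G := by
  have hz : μ (⋃ q : ℚ, frontier {x | ENNReal.ofReal q ≤ G x}) = 0 :=
    measure_iUnion_null fun q => (convex_level G hG _).addHaar_frontier μ
  refine measure_mono_null ?_ hz
  intro x hx
  have hx : hull G x ≠ G x := hx
  have hlt := lt_of_le_of_ne (le_hull G x) hx.symm
  obtain ⟨q, -, h1, h2⟩ := ENNReal.lt_iff_exists_rat_btwn.1 hlt
  refine Set.mem_iUnion.2 ⟨q, ?_, fun h => ?_⟩
  · rw [mem_closure_iff_frequently]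
    exact (Filter.frequently_lt_of_lt_limsup (h := h2)).mono fun y hy => hy.le
  · exact absurd (interior_subset h) (not_le.2 h1)

lemma gauss_lc {d : ℕ} (σ : ℝ) (hσ : 0 < σ) (x y : EuclideanSpace ℝ (Fin d)) (a b : ℝ)
    (ha : 0 < a) (hb : 0 < b) (hab : a + b = 1) :
    Real.exp (-‖x‖ ^ 2 / (2 * σ)) ^ a * Real.exp (-‖y‖ ^ 2 / (2 * σ)) ^ b ≤
      Real.exp (-‖a • x + b • y‖ ^ 2 / (2 * σ)) := by
  rw [← Real.exp_mul, ← Real.exp_mul, ← Real.exp_add, Real.exp_le_exp,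
    div_mul_eq_mul_div, div_mul_eq_mul_div, ← add_div]
  gcongr
  have h1 : ‖a • x + b • y‖ ≤ a * ‖x‖ + b * ‖y‖ := by
    refine (norm_add_le _ _).trans (le_of_eq ?_)
    rw [norm_smul, norm_smul, Real.norm_of_nonneg ha.le, Real.norm_of_nonneg hb.le]
  have h2 : ‖a • x + b • y‖ ^ 2 ≤ (a * ‖x‖ + b * ‖y‖) ^ 2 := by gcongr
  have : b = 1 - a := by linarith
  have h3 : (a * ‖x‖ + b * ‖y‖) ^ 2 ≤ a * ‖x‖ ^ 2 + b * ‖y‖ ^ 2 := by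
    have : a * ‖x‖ ^ 2 + b * ‖y‖ ^ 2 - (a * ‖x‖ + b * ‖y‖) ^ 2 = a * b * (‖x‖ - ‖y‖) ^ 2 := by
      subst this; ring
    have : 0 ≤ a * b * (‖x‖ - ‖y‖) ^ 2 := by positivity
    linarith
  linarith

lemma integral_prekopa {d : ℕ} (e σ : ℝ) (hσ : 0 < σ) (G : EuclideanSpace ℝ (Fin d) → ℝ)
    (hG : LogConcaveFn G)
    (hInt : ∀ x, Integrable (fun y => G (y + e • x) * Real.exp (-‖y‖ ^ 2 / (2 * σ))))
    (x y : EuclideanSpace ℝ (Fin d)) (a b : ℝ) (ha : 0 < a) (hb : 0 < b) (hab : a + b = 1) :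
    (∫ w, G (w + e • x) * Real.exp (-‖w‖ ^ 2 / (2 * σ))) ^ a *
      (∫ w, G (w + e • y) * Real.exp (-‖w‖ ^ 2 / (2 * σ))) ^ b ≤
      ∫ w, G (w + e • (a • x + b • y)) * Real.exp (-‖w‖ ^ 2 / (2 * σ)) := by
  set G' : EuclideanSpace ℝ (Fin d) → ENNReal := fun x => ENNReal.ofReal (G x) with hG'
  have lc : LCE G' := by
    intro x y a b ha hb hab
    simp only [hG']
    rw [ENNReal.ofReal_rpow_of_nonneg (hG.1 x) ha.le, ENNReal.ofReal_rpow_of_nonneg (hG.1 y) hb.le,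
      ← ENNReal.ofReal_mul (Real.rpow_nonneg (hG.1 x) _)]
    exact ENNReal.ofReal_le_ofReal (hG.2 x y a b ha.le hb.le hab)
  have lch := hull_lce G' lc
  have mh := hull_measurable G'
  set F : EuclideanSpace ℝ (Fin d) × (Fin d → ℝ) → ENNReal := fun p =>
    hull G' (WithLp.toLp 2 p.2 + e • p.1) *
      ENNReal.ofReal (Real.exp (-‖WithLp.toLp 2 p.2‖ ^ 2 / (2 * σ))) with hF
  have mF : Measurable F := by
    have : Measurable (fun p : EuclideanSpace ℝ (Fin d) × (Fin d → ℝ) =>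
        (WithLp.toLp 2 p.2 : EuclideanSpace ℝ (Fin d))) := by fun_prop
    have h1 : Measurable (fun p : EuclideanSpace ℝ (Fin d) × (Fin d → ℝ) =>
        (WithLp.toLp 2 p.2 : EuclideanSpace ℝ (Fin d)) + e • p.1) :=
      this.add (by fun_prop)
    exact (mh.comp h1).mul (by fun_prop)
  have lF : LCE F := by
    intro p q a b ha hb hab
    simp only [hF]
    rw [ENNReal.mul_rpow_of_nonneg _ _ ha.le, ENNReal.mul_rpow_of_nonneg _ _ hb.le,
      mul_mul_mul_comm]
    refine mul_le_mul' ?_ ?_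
    · refine (lch _ _ a b ha hb hab).trans (le_of_eq ?_)
      congr 1
      simp only [Prod.snd_add, Prod.smul_snd, Prod.fst_add, Prod.smul_fst, WithLp.toLp_add,
        WithLp.toLp_smul]
      module
    · rw [ENNReal.ofReal_rpow_of_pos (by positivity), ENNReal.ofReal_rpow_of_pos (by positivity),
        ← ENNReal.ofReal_mul (by positivity)]
      exact ENNReal.ofReal_le_ofReal (gauss_lc σ hσ _ _ a b ha hb hab)
  have eq : ∀ x, ∫⁻ t, F (x, t) =
      ENNReal.ofReal (∫ w, G (w + e • x) * Real.exp (-‖w‖ ^ 2 / (2 * σ))) := by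
    intro x
    rw [ofReal_integral_eq_lintegral_ofReal (hInt x)
      (.of_forall fun w => mul_nonneg (hG.1 _) (Real.exp_pos _).le)]
    simp only [hF]
    have m2 : Measurable (fun w : EuclideanSpace ℝ (Fin d) => hull G' (w + e • x) *
      ENNReal.ofReal (Real.exp (-‖w‖ ^ 2 / (2 * σ)))) :=
      (mh.comp (by fun_prop)).mul (by fun_prop)
    rw [(PiLp.volume_preserving_toLp (Fin d)).lintegral_comp m2]
    have hae := (measurePreserving_add_right volume (e • x)).quasiMeasurePreserving.ae_eq_comp
      (hull_ae volume G' lc)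
    refine lintegral_congr_ae ?_
    filter_upwards [hae] with w hw
    simp only [Function.comp] at hw
    rw [hw, hG', ENNReal.ofReal_mul (hG.1 _)]
  have nn : ∀ x, 0 ≤ ∫ w, G (w + e • x) * Real.exp (-‖w‖ ^ 2 / (2 * σ)) := fun x =>
    integral_nonneg fun w => mul_nonneg (hG.1 _) (Real.exp_pos _).le
  have := prekopa d F mF lF x y a b ha hb hab
  simp only [eq] at this
  rwa [ENNReal.ofReal_rpow_of_nonneg (nn x) ha.le, ENNReal.ofReal_rpow_of_nonneg (nn y) hb.le,
      ← ENNReal.ofReal_mul (Real.rpow_nonneg (nn x) _), ENNReal.ofReal_le_ofReal_iff (nn _)] at this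

lemma integral_holder {d : ℕ} (e σ : ℝ) (h : EuclideanSpace ℝ (Fin d) → ℝ)
    (hh : ConvexOn ℝ Set.univ h)
    (hInt : ∀ x, Integrable (fun y => Real.exp (h (y + e • x)) * Real.exp (-‖y‖ ^ 2 / (2 * σ))))
    (hp : ∀ x, 0 < ∫ w, Real.exp (h (w + e • x)) * Real.exp (-‖w‖ ^ 2 / (2 * σ)))
    (x y : EuclideanSpace ℝ (Fin d)) (a b : ℝ) (ha : 0 ≤ a) (hb : 0 ≤ b) (hab : a + b = 1) :
    ∫ w, Real.exp (h (w + e • (a • x + b • y))) * Real.exp (-‖w‖ ^ 2 / (2 * σ)) ≤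
    (∫ w, Real.exp (h (w + e • x)) * Real.exp (-‖w‖ ^ 2 / (2 * σ))) ^ a *
      (∫ w, Real.exp (h (w + e • y)) * Real.exp (-‖w‖ ^ 2 / (2 * σ))) ^ b := by
  have hA := hp x
  have hB := hp y
  set A := ∫ w, Real.exp (h (w + e • x)) * Real.exp (-‖w‖ ^ 2 / (2 * σ)) with hAd
  set B := ∫ w, Real.exp (h (w + e • y)) * Real.exp (-‖w‖ ^ 2 / (2 * σ)) with hBd
  have pt : ∀ w, Real.exp (h (w + e • (a • x + b • y))) * Real.exp (-‖w‖ ^ 2 / (2 * σ)) ≤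
      (A ^ a * B ^ b) * ((a / A) * (Real.exp (h (w + e • x)) * Real.exp (-‖w‖ ^ 2 / (2 * σ))) +
        (b / B) * (Real.exp (h (w + e • y)) * Real.exp (-‖w‖ ^ 2 / (2 * σ)))) := by
    intro w
    have h1 : h (w + e • (a • x + b • y)) ≤ a * h (w + e • x) + b * h (w + e • y) := by
      have := hh.2 (Set.mem_univ (w + e • x)) (Set.mem_univ (w + e • y)) ha hb hab
      have e1 : a • (w + e • x) + b • (w + e • y) = w + e • (a • x + b • y) := by
        have : b = 1 - a := by linarith
        subst this; module
      rw [e1] at this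
      simpa using this
    have h2 : Real.exp (h (w + e • (a • x + b • y))) ≤
        Real.exp (h (w + e • x)) ^ a * Real.exp (h (w + e • y)) ^ b := by
      rw [← Real.exp_mul, ← Real.exp_mul, ← Real.exp_add, Real.exp_le_exp]
      linarith
    have h3 := Real.geom_mean_le_arith_mean2_weighted ha hb
      (div_pos (Real.exp_pos (h (w + e • x))) hA).le
      (div_pos (Real.exp_pos (h (w + e • y))) hB).le hab
    rw [Real.div_rpow (Real.exp_pos _).le hA.le, Real.div_rpow (Real.exp_pos _).le hB.le,
      div_mul_div_comm, div_le_iff₀ (by positivity)] at h3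
    calc _ ≤ _ := mul_le_mul_of_nonneg_right (h2.trans h3) (Real.exp_pos _).le
      _ = _ := by ring
  have i1 := (hInt x).const_mul (a / A)
  have i2 := (hInt y).const_mul (b / B)
  refine (integral_mono (hInt _) ((i1.add i2).const_mul _) pt).trans (le_of_eq ?_)
  rw [integral_const_mul]
  simp only [Pi.add_apply]
  rw [integral_add i1 i2, integral_const_mul, integral_const_mul, ← hAd, ← hBd,
    div_mul_cancel₀ _ hA.ne', div_mul_cancel₀ _ hB.ne', hab, mul_one]

/-- If `V` is convex, `W` is convex (i.e. `ρ = e^{-W}` is log-concave) and `h` is convex, then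
`Φ^ε(h) = V - log P^ε(e^{-W}/P^ε(e^h))` is convex. -/
theorem stmt6 (d : ℕ) (ε : ℝ) (hε : 0 < ε)
    (V h : EuclideanSpace ℝ (Fin d) → ℝ) (ρ : EuclideanSpace ℝ (Fin d) → ℝ)
    (hV : ConvexOn ℝ Set.univ V) (hρ : LogConcaveFn ρ) (hh : ConvexOn ℝ Set.univ h)
    (hint1 : ∀ x, Integrable (fun y => Real.exp (h (y + Real.exp (-ε / 2) • x)) *
      Real.exp (-‖y‖ ^ 2 / (2 * (1 - Real.exp (-ε))))))
    (hint2 : ∀ x, Integrable (fun y =>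
      (ρ (y + Real.exp (-ε / 2) • x) / OU d ε (fun z => Real.exp (h z)) (y + Real.exp (-ε / 2) • x)) *
      Real.exp (-‖y‖ ^ 2 / (2 * (1 - Real.exp (-ε))))))
    (hpos : ∀ x, 0 < OU d ε (fun y => ρ y / OU d ε (fun z => Real.exp (h z)) y) x) :
    ConvexOn ℝ Set.univ (fun x =>
      V x - Real.log (OU d ε (fun y => ρ y / OU d ε (fun z => Real.exp (h z)) y) x)) := by
  have hσ : 0 < 1 - Real.exp (-ε) := by
    have : Real.exp (-ε) < 1 := by simpa using hε
    linarith
  have hc : 0 < (2 * π * (1 - Real.exp (-ε))) ^ (-(d : ℝ) / 2) := by positivity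
  have hI : ∀ x, 0 < ∫ w, Real.exp (h (w + Real.exp (-ε / 2) • x)) *
      Real.exp (-‖w‖ ^ 2 / (2 * (1 - Real.exp (-ε)))) := by
    intro x
    rw [integral_pos_iff_support_of_nonneg (fun w => by positivity) (hint1 x)]
    have : (Function.support fun w => Real.exp (h (w + Real.exp (-ε / 2) • x)) *
      Real.exp (-‖w‖ ^ 2 / (2 * (1 - Real.exp (-ε))))) = Set.univ := by
      ext w; simp [Real.exp_ne_zero]
    rw [this]
    exact isOpen_univ.measure_pos _ Set.univ_nonempty
  have split : ∀ (c X Y a b : ℝ), 0 < c → 0 ≤ X → 0 ≤ Y → a + b = 1 →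
      (c * X) ^ a * (c * Y) ^ b = c * (X ^ a * Y ^ b) := by
    intro c X Y a b hc hX hY hab
    rw [Real.mul_rpow hc.le hX, Real.mul_rpow hc.le hY, mul_mul_mul_comm, ← Real.rpow_add hc, hab,
      Real.rpow_one]
  have hP : ∀ x, 0 < OU d ε (fun z => Real.exp (h z)) x := fun x => mul_pos hc (hI x)
  have hPc : ∀ x y : EuclideanSpace ℝ (Fin d), ∀ a b : ℝ, 0 ≤ a → 0 ≤ b → a + b = 1 →
      OU d ε (fun z => Real.exp (h z)) (a • x + b • y) ≤
      OU d ε (fun z => Real.exp (h z)) x ^ a * OU d ε (fun z => Real.exp (h z)) y ^ b := by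
    intro x y a b ha hb hab
    unfold OU
    rw [split _ _ _ a b hc (hI x).le (hI y).le hab]
    exact mul_le_mul_of_nonneg_left (integral_holder _ _ h hh hint1 hI x y a b ha hb hab) hc.le
  set P := OU d ε (fun z => Real.exp (h z)) with hPd
  have hG : LogConcaveFn (fun y => ρ y / P y) := by
    refine ⟨fun x => div_nonneg (hρ.1 x) (hP x).le, fun x y a b ha hb hab => ?_⟩
    dsimp only
    rw [Real.div_rpow (hρ.1 x) (hP x).le, Real.div_rpow (hρ.1 y) (hP y).le, div_mul_div_comm]
    exact div_le_div₀ (hρ.1 _) (hρ.2 x y a b ha hb hab) (hP _) (hPc x y a b ha hb hab)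
  refine convexOn_iff_forall_pos.2 ⟨convex_univ, fun x _ y _ a b ha hb hab => ?_⟩
  have hVc := hV.2 (Set.mem_univ x) (Set.mem_univ y) ha.le hb.le hab
  have nn : ∀ x, 0 ≤ ∫ w, (ρ (w + Real.exp (-ε / 2) • x) / P (w + Real.exp (-ε / 2) • x)) *
      Real.exp (-‖w‖ ^ 2 / (2 * (1 - Real.exp (-ε)))) := fun x =>
    integral_nonneg fun w => mul_nonneg (hG.1 _) (Real.exp_pos _).le
  have key : OU d ε (fun y => ρ y / P y) x ^ a * OU d ε (fun y => ρ y / P y) y ^ b ≤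
      OU d ε (fun y => ρ y / P y) (a • x + b • y) := by
    have := integral_prekopa _ _ hσ (fun y => ρ y / P y) hG hint2 x y a b ha hb hab
    unfold OU
    rw [split _ _ _ a b hc (nn x) (nn y) hab]
    exact mul_le_mul_of_nonneg_left this hc.le
  have hx := hpos x
  have hy := hpos y
  have hlog := Real.log_le_log (by positivity) key
  rw [Real.log_mul (by positivity) (by positivity), Real.log_rpow hx, Real.log_rpow hy] at hlog
  simp only [smul_eq_mul] at hVc ⊢
  linarith
end
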